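/- arXiv:2201.04981 — 6 statements merged into one kernel-verified Lean document; each statement's English description precedes it below -/
import Mathlib

section
/- For every positive integer x such that C_τ(x) > 0 and P(X ≥ x) > 0, one has f_{*,τ}(x)/C_τ(x) = P(X = x)/P(X ≥ x); that is, the ratio of the conditional-observation quantities f_{*,τ} and C_τ recovers the hazard rate λ(x) of the untruncated lifetime X. -/
open MeasureTheory ProbabilityTheory Filter Finset

/-- The ratio `f_{*,τ}(x)/C_τ(x)` recovers the hazard rate of `X`. -/
theorem stmt8
    {Ω : Type*} [MeasurableSpace Ω] (P : Measure Ω) [IsProbabilityMeasure P]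
    (X Y : Ω → ℤ) (hX : Measurable X) (hY : Measurable Y)
    (hXpos : ∀ ω, 0 < X ω) (hYpos : ∀ ω, 0 < Y ω)
    (hindep : IndepFun X Y P)
    (τ : ℤ) (hτ : 0 ≤ τ)
    (α : ℝ) (hα : α = (P {ω | Y ω ≤ X ω}).toReal) (hαpos : 0 < α)
    (fstar Cτ : ℤ → ℝ)
    (hfstar : ∀ x : ℤ, fstar x =
      (P ({ω | X ω = x ∧ X ω ≤ Y ω + τ} ∩ {ω | Y ω ≤ X ω})).toReal / α)
    (hCτ : ∀ x : ℤ, Cτ x =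
      (P ({ω | Y ω ≤ x ∧ x ≤ X ω ∧ x ≤ Y ω + τ} ∩ {ω | Y ω ≤ X ω})).toReal / α) :
    ∀ x : ℤ, 0 < x → 0 < Cτ x → 0 < (P {ω | x ≤ X ω}).toReal →
      fstar x / Cτ x = (P {ω | X ω = x}).toReal / (P {ω | x ≤ X ω}).toReal := by
  intro x hx hC hS
  have key : ∀ A : Set ℤ, P (X ⁻¹' A ∩ Y ⁻¹' {y | y ≤ x ∧ x ≤ y + τ})
      = P (X ⁻¹' A) * P (Y ⁻¹' {y | y ≤ x ∧ x ≤ y + τ}) := fun A =>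
    hindep.measure_inter_preimage_eq_mul A _ (MeasurableSet.of_discrete)
      (MeasurableSet.of_discrete)
  have e1 : ({ω | X ω = x ∧ X ω ≤ Y ω + τ} ∩ {ω | Y ω ≤ X ω})
      = X ⁻¹' {z | z = x} ∩ Y ⁻¹' {y | y ≤ x ∧ x ≤ y + τ} := by
    ext ω
    simp only [Set.mem_inter_iff, Set.mem_setOf_eq, Set.mem_preimage]
    constructor
    · rintro ⟨⟨h1, h2⟩, h3⟩
      exact ⟨h1, by omega, by omega⟩
    · rintro ⟨h1, h2, h3⟩
      exact ⟨⟨h1, by omega⟩, by omega⟩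
  have e2 : ({ω | Y ω ≤ x ∧ x ≤ X ω ∧ x ≤ Y ω + τ} ∩ {ω | Y ω ≤ X ω})
      = X ⁻¹' {z | x ≤ z} ∩ Y ⁻¹' {y | y ≤ x ∧ x ≤ y + τ} := by
    ext ω
    simp only [Set.mem_inter_iff, Set.mem_setOf_eq, Set.mem_preimage]
    constructor
    · rintro ⟨⟨h1, h2, h3⟩, h4⟩
      exact ⟨h2, h1, h3⟩
    · rintro ⟨h1, h2, h3⟩
      exact ⟨⟨h2, h1, h3⟩, by omega⟩
  have hf := hfstar x
  have hc := hCτ x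
  rw [e1, key, ENNReal.toReal_mul] at hf
  rw [e2, key, ENNReal.toReal_mul] at hc
  have s1 : X ⁻¹' {z | z = x} = {ω | X ω = x} := rfl
  have s2 : X ⁻¹' {z | x ≤ z} = {ω | x ≤ X ω} := rfl
  rw [s1] at hf
  rw [s2] at hc
  generalize (P (Y ⁻¹' {y | y ≤ x ∧ x ≤ y + τ})).toReal = q at hf hc
  have hq : q ≠ 0 := by
    rintro rfl
    simp [hc] at hC
  have hα0 := hαpos.ne'
  have hS0 := hS.ne'
  rw [hf, hc]
  field_simp
end

section
/- For every positive integer x, C_τ(x) := P(Y ≤ x ≤ min(X, C) | X ≥ Y) = P(Y ≤ x ≤ C)·P(X ≥ x)/α, where α := P(X ≥ Y). -/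
open MeasureTheory ProbabilityTheory Filter Finset

/-- Factorization of `C_τ(x) = P(Y ≤ x ≤ min(X, C) ∣ X ≥ Y)`,
where `C = Y + τ`. -/
theorem stmt9
    {Ω : Type*} [MeasurableSpace Ω] (P : Measure Ω) [IsProbabilityMeasure P]
    (X Y : Ω → ℤ) (hX : Measurable X) (hY : Measurable Y)
    (hXpos : ∀ ω, 0 < X ω) (hYpos : ∀ ω, 0 < Y ω)
    (hindep : IndepFun X Y P)
    (τ : ℤ) (hτ : 0 ≤ τ)
    (α : ℝ) (hα : α = (P {ω | Y ω ≤ X ω}).toReal) (hαpos : 0 < α)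
    :
    ∀ x : ℤ, 0 < x →
      (P ({ω | Y ω ≤ x ∧ x ≤ X ω ∧ x ≤ Y ω + τ} ∩ {ω | Y ω ≤ X ω})).toReal / α
        = (P {ω | Y ω ≤ x ∧ x ≤ Y ω + τ}).toReal * (P {ω | x ≤ X ω}).toReal / α := by
  intro x hx
  have h := hindep.measure_inter_preimage_eq_mul (Set.Ici x) {y : ℤ | y ≤ x ∧ x ≤ y + τ}
    (MeasurableSet.of_discrete) (MeasurableSet.of_discrete)
  have e : ({ω | Y ω ≤ x ∧ x ≤ X ω ∧ x ≤ Y ω + τ} ∩ {ω | Y ω ≤ X ω})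
      = X ⁻¹' (Set.Ici x) ∩ Y ⁻¹' {y : ℤ | y ≤ x ∧ x ≤ y + τ} := by
    ext ω
    simp only [Set.mem_inter_iff, Set.mem_setOf_eq, Set.mem_preimage, Set.mem_Ici]
    omega
  rw [e, h, ENNReal.toReal_mul, mul_comm]
  rfl
end

section
/- For all positive integers k and k', r_τ(k,k') := P(X = max(k,k'), Y ≤ min(k,k'), X ≤ C | X ≥ Y) = P(X = max(k,k'))·P(Y ≤ min(k,k'), C ≥ max(k,k'))/α, where α := P(X ≥ Y). In particular r_τ(k,k') = r_τ(k',k) and r_τ(k,k) = f_{*,τ}(k), where f_{*,τ}(x) := P(X = x, X ≤ C | X ≥ Y). -/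
open MeasureTheory ProbabilityTheory Filter Finset

/-- Factorization, symmetry, and diagonal of
`r_τ(k,k') = P(X = max(k,k'), Y ≤ min(k,k'), X ≤ C ∣ X ≥ Y)`, `C = Y + τ`. -/
theorem stmt12
    {Ω : Type*} [MeasurableSpace Ω] (P : Measure Ω) [IsProbabilityMeasure P]
    (X Y : Ω → ℤ) (hX : Measurable X) (hY : Measurable Y)
    (hXpos : ∀ ω, 0 < X ω) (hYpos : ∀ ω, 0 < Y ω)
    (hindep : IndepFun X Y P)
    (τ : ℤ) (hτ : 0 ≤ τ)
    (α : ℝ) (hα : α = (P {ω | Y ω ≤ X ω}).toReal) (hαpos : 0 < α)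
    (rτ : ℤ → ℤ → ℝ)
    (hrτ : ∀ k k' : ℤ, rτ k k' =
      (P ({ω | X ω = max k k' ∧ Y ω ≤ min k k' ∧ X ω ≤ Y ω + τ}
        ∩ {ω | Y ω ≤ X ω})).toReal / α)
    (fstar : ℤ → ℝ)
    (hfstar : ∀ x : ℤ, fstar x =
      (P ({ω | X ω = x ∧ X ω ≤ Y ω + τ} ∩ {ω | Y ω ≤ X ω})).toReal / α) :
    ∀ k k' : ℤ, 0 < k → 0 < k' →
      (rτ k k' = (P {ω | X ω = max k k'}).toReal
          * (P {ω | Y ω ≤ min k k' ∧ max k k' ≤ Y ω + τ}).toReal / α)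
        ∧ rτ k k' = rτ k' k
        ∧ rτ k k = fstar k := by
  intro k k' hk hk'
  refine ⟨?_, ?_, ?_⟩
  · have h := hindep.measure_inter_preimage_eq_mul {max k k'}
      {y | y ≤ min k k' ∧ max k k' ≤ y + τ}
      (MeasurableSet.of_discrete) (MeasurableSet.of_discrete)
    have e : {ω | X ω = max k k' ∧ Y ω ≤ min k k' ∧ X ω ≤ Y ω + τ} ∩ {ω | Y ω ≤ X ω}
        = X ⁻¹' {max k k'} ∩ Y ⁻¹' {y | y ≤ min k k' ∧ max k k' ≤ y + τ} := by
      ext ω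
      simp only [Set.mem_inter_iff, Set.mem_setOf_eq, Set.mem_preimage, Set.mem_singleton_iff]
      omega
    rw [hrτ, e, h, ENNReal.toReal_mul]
    rfl
  · rw [hrτ, hrτ, max_comm, min_comm]
  · rw [hrτ, hfstar]
    congr 3
    ext ω
    simp only [Set.mem_inter_iff, Set.mem_setOf_eq]
    omega
end

section
/- For all positive integers k and k', f_{*,τ}(max(k,k')) · c_τ(k,k') = r_τ(k,k') · C_τ(max(k,k')), where f_{*,τ}(x) := P(X = x, X ≤ C | X ≥ Y), C_τ(x) := P(Y ≤ x ≤ min(X, C) | X ≥ Y), c_τ(k,k') := P(Y ≤ min(k,k'), X ≥ max(k,k'), C ≥ max(k,k') | X ≥ Y), and r_τ(k,k') := P(X = max(k,k'), Y ≤ min(k,k'), X ≤ C | X ≥ Y). -/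
open MeasureTheory ProbabilityTheory Filter Finset

/-- The identity `f_{*,τ}(max(k,k')) · c_τ(k,k') = r_τ(k,k') · C_τ(max(k,k'))`. -/
theorem stmt13
    {Ω : Type*} [MeasurableSpace Ω] (P : Measure Ω) [IsProbabilityMeasure P]
    (X Y : Ω → ℤ) (hX : Measurable X) (hY : Measurable Y)
    (hXpos : ∀ ω, 0 < X ω) (hYpos : ∀ ω, 0 < Y ω)
    (hindep : IndepFun X Y P)
    (τ : ℤ) (hτ : 0 ≤ τ)
    (α : ℝ) (hα : α = (P {ω | Y ω ≤ X ω}).toReal) (hαpos : 0 < α)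
    (fstar Cτ : ℤ → ℝ) (cτ rτ : ℤ → ℤ → ℝ)
    (hfstar : ∀ x : ℤ, fstar x =
      (P ({ω | X ω = x ∧ X ω ≤ Y ω + τ} ∩ {ω | Y ω ≤ X ω})).toReal / α)
    (hCτ : ∀ x : ℤ, Cτ x =
      (P ({ω | Y ω ≤ x ∧ x ≤ X ω ∧ x ≤ Y ω + τ} ∩ {ω | Y ω ≤ X ω})).toReal / α)
    (hcτ : ∀ k k' : ℤ, cτ k k' =
      (P ({ω | Y ω ≤ min k k' ∧ max k k' ≤ X ω ∧ max k k' ≤ Y ω + τ}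
        ∩ {ω | Y ω ≤ X ω})).toReal / α)
    (hrτ : ∀ k k' : ℤ, rτ k k' =
      (P ({ω | X ω = max k k' ∧ Y ω ≤ min k k' ∧ X ω ≤ Y ω + τ}
        ∩ {ω | Y ω ≤ X ω})).toReal / α) :
    ∀ k k' : ℤ, 0 < k → 0 < k' →
      fstar (max k k') * cτ k k' = rτ k k' * Cτ (max k k') := by
  intro k k' _ _
  have key : ∀ (A B : Set ℤ) (S : Set Ω), S = X ⁻¹' A ∩ Y ⁻¹' B →
      (P S).toReal = (P (X ⁻¹' A)).toReal * (P (Y ⁻¹' B)).toReal := by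
    intro A B S hS
    rw [hS, hindep.measure_inter_preimage_eq_mul A B (MeasurableSet.of_discrete)
      (MeasurableSet.of_discrete), ENNReal.toReal_mul]
  have hmM : min k k' ≤ max k k' := min_le_max
  rw [hfstar, hCτ, hcτ, hrτ]
  generalize max k k' = M at *
  generalize min k k' = m at *
  rw [key {M} (Set.Icc (M - τ) M) ({ω | X ω = M ∧ X ω ≤ Y ω + τ} ∩ {ω | Y ω ≤ X ω})
      (by ext ω; simp only [Set.mem_inter_iff, Set.mem_setOf_eq, Set.mem_preimage,
            Set.mem_singleton_iff, Set.mem_Icc]; omega),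
    key (Set.Ici M) (Set.Icc (M - τ) m)
      ({ω | Y ω ≤ m ∧ M ≤ X ω ∧ M ≤ Y ω + τ} ∩ {ω | Y ω ≤ X ω})
      (by ext ω; simp only [Set.mem_inter_iff, Set.mem_setOf_eq, Set.mem_preimage,
            Set.mem_Ici, Set.mem_Icc]; omega),
    key {M} (Set.Icc (M - τ) m)
      ({ω | X ω = M ∧ Y ω ≤ m ∧ X ω ≤ Y ω + τ} ∩ {ω | Y ω ≤ X ω})
      (by ext ω; simp only [Set.mem_inter_iff, Set.mem_setOf_eq, Set.mem_preimage,
            Set.mem_singleton_iff, Set.mem_Icc]; omega),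
    key (Set.Ici M) (Set.Icc (M - τ) M)
      ({ω | Y ω ≤ M ∧ M ≤ X ω ∧ M ≤ Y ω + τ} ∩ {ω | Y ω ≤ X ω})
      (by ext ω; simp only [Set.mem_inter_iff, Set.mem_setOf_eq, Set.mem_preimage,
            Set.mem_Ici, Set.mem_Icc]; omega)]
  ring
end

section
/- Let (X*, Y*) be a random pair whose joint law equals the conditional joint law of (X, Y) given X ≥ Y, set C* := Y* + τ, and for each positive integer k define Z_{τ,k} := 1{X* = k, X* ≤ C*}·C_τ(k) − f_{*,τ}(k)·1{Y* ≤ k ≤ min(X*, C*)}. Then for all positive integers k and k', Cov[Z_{τ,k}, Z_{τ,k'}] = C_τ(k)·f_{*,τ}(k)·(C_τ(k) − f_{*,τ}(k)) if k = k', and Cov[Z_{τ,k}, Z_{τ,k'}] = 0 if k ≠ k'. -/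
open MeasureTheory ProbabilityTheory Filter Finset

/-- Covariance structure of the random variables `Z_{τ,k}`:
the components are uncorrelated, with
`Var[Z_{τ,k}] = C_τ(k)·f_{*,τ}(k)·(C_τ(k) − f_{*,τ}(k))`. -/
theorem stmt15
    {Ω : Type*} [MeasurableSpace Ω] (P : Measure Ω) [IsProbabilityMeasure P]
    (X Y : Ω → ℤ) (hX : Measurable X) (hY : Measurable Y)
    (hXpos : ∀ ω, 0 < X ω) (hYpos : ∀ ω, 0 < Y ω)
    (hindep : IndepFun X Y P)
    (τ : ℤ) (hτ : 0 ≤ τ)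
    (α : ℝ) (hα : α = (P {ω | Y ω ≤ X ω}).toReal) (hαpos : 0 < α)
    (fstar Cτ : ℤ → ℝ)
    (hfstar : ∀ x : ℤ, fstar x =
      (P ({ω | X ω = x ∧ X ω ≤ Y ω + τ} ∩ {ω | Y ω ≤ X ω})).toReal / α)
    (hCτ : ∀ x : ℤ, Cτ x =
      (P ({ω | Y ω ≤ x ∧ x ≤ X ω ∧ x ≤ Y ω + τ} ∩ {ω | Y ω ≤ X ω})).toReal / α)
    -- the pair `(X*, Y*)` with the conditional joint law of `(X, Y)` given `X ≥ Y`
    {Ω' : Type*} [MeasurableSpace Ω'] (Q : Measure Ω') [IsProbabilityMeasure Q]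
    (Xst Yst : Ω' → ℤ) (hXst : Measurable Xst) (hYst : Measurable Yst)
    (hlaw : Measure.map (fun ω => (Xst ω, Yst ω)) Q
      = Measure.map (fun ω => (X ω, Y ω)) (P[|{ω | Y ω ≤ X ω}]))
    -- the random variable `Z_{τ,k}`, built from `X*`, `Y*` and `C* = Y* + τ`
    (Zτ : ℤ → Ω' → ℝ)
    (hZτ : ∀ (k : ℤ) (ω : Ω'), Zτ k ω =
      (if Xst ω = k ∧ Xst ω ≤ Yst ω + τ then (1 : ℝ) else 0) * Cτ k
        - fstar k * (if Yst ω ≤ k ∧ k ≤ min (Xst ω) (Yst ω + τ) then (1 : ℝ) else 0))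
    :
    ∀ k k' : ℤ, 0 < k → 0 < k' →
      (∫ ω, Zτ k ω * Zτ k' ω ∂Q) - (∫ ω, Zτ k ω ∂Q) * (∫ ω, Zτ k' ω ∂Q)
        = if k = k' then Cτ k * fstar k * (Cτ k - fstar k) else 0 := by
  classical
  have hmeasA : MeasurableSet {ω | Y ω ≤ X ω} := measurableSet_le hY hX
  have hpair : Measurable (fun ω => (X ω, Y ω)) := hX.prodMk hY
  have hpair' : Measurable (fun ω => (Xst ω, Yst ω)) := hXst.prodMk hYst
  have hQ : ∀ U : Set (ℤ × ℤ), Q.real {ω | (Xst ω, Yst ω) ∈ U} =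
      (P ({ω | (X ω, Y ω) ∈ U} ∩ {ω | Y ω ≤ X ω})).toReal / α := by
    intro U
    have hU : MeasurableSet U := U.to_countable.measurableSet
    have h1 := congrArg (fun m => m U) hlaw
    simp only [Measure.map_apply hpair hU, Measure.map_apply hpair' hU,
      cond_apply hmeasA] at h1
    have h2 : Q {ω | (Xst ω, Yst ω) ∈ U} = _ := h1
    rw [Measure.real, h2, ENNReal.toReal_mul, ENNReal.toReal_inv, ← hα, Set.inter_comm,
      div_eq_inv_mul]
    rfl
  have hae : ∀ᵐ ω ∂Q, Yst ω ≤ Xst ω := by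
    have h1 := hQ {p | ¬ p.2 ≤ p.1}
    have h2 : ({ω | (X ω, Y ω) ∈ {p : ℤ × ℤ | ¬ p.2 ≤ p.1}} ∩ {ω | Y ω ≤ X ω}) = ∅ := by
      ext ω; simp
    rw [h2] at h1
    simp only [measure_empty, ENNReal.toReal_zero, zero_div] at h1
    rw [ae_iff]
    exact (measureReal_eq_zero_iff).1 h1
  let I : Set ℤ → Set ℤ → Ω' → ℝ := fun S T ω => if Xst ω ∈ S ∧ Yst ω ∈ T then 1 else 0
  have hIm : ∀ S T : Set ℤ, MeasurableSet {ω | Xst ω ∈ S ∧ Yst ω ∈ T} := fun S T =>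
    (hXst S.to_countable.measurableSet).inter (hYst T.to_countable.measurableSet)
  have hIeq : ∀ S T, I S T = Set.indicator {ω | Xst ω ∈ S ∧ Yst ω ∈ T} (fun _ => (1 : ℝ)) := by
    intro S T; ext ω; simp [I, Set.indicator_apply]
  have hIint : ∀ S T, Integrable (I S T) Q := by
    intro S T; rw [hIeq]; exact (integrable_const _).indicator (hIm S T)
  have hIval0 : ∀ S T, ∫ ω, I S T ω ∂Q = Q.real {ω | Xst ω ∈ S ∧ Yst ω ∈ T} := by
    intro S T
    rw [hIeq, integral_indicator (hIm S T)]
    simp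
  have hind : ∀ S T : Set ℤ, (P ({ω | X ω ∈ S ∧ Y ω ∈ T})).toReal =
      P.real (X ⁻¹' S) * P.real (Y ⁻¹' T) := by
    intro S T
    have := hindep.measure_inter_preimage_eq_mul S T S.to_countable.measurableSet
      T.to_countable.measurableSet
    rw [Measure.real, Measure.real, ← ENNReal.toReal_mul, ← this]
    rfl
  have hIval : ∀ S T : Set ℤ, (∀ x ∈ S, ∀ y ∈ T, y ≤ x) →
      ∫ ω, I S T ω ∂Q = P.real (X ⁻¹' S) * P.real (Y ⁻¹' T) / α := by
    intro S T hST
    rw [hIval0, ← hind]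
    have h1 := hQ (S ×ˢ T)
    have h2 : {ω | (X ω, Y ω) ∈ S ×ˢ T} ∩ {ω | Y ω ≤ X ω} = {ω | X ω ∈ S ∧ Y ω ∈ T} := by
      ext ω
      simp only [Set.mem_inter_iff, Set.mem_setOf_eq, Set.mem_prod, and_iff_left_iff_imp]
      exact fun h => hST _ h.1 _ h.2
    rw [h2] at h1
    exact h1
  have hlin : ∀ (c d : ℝ) (S T S' T' : Set ℤ), ∫ ω, (c * I S T ω + d * I S' T' ω) ∂Q =
      c * ∫ ω, I S T ω ∂Q + d * ∫ ω, I S' T' ω ∂Q := by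
    intro c d S T S' T'
    rw [integral_add ((hIint S T).const_mul c) ((hIint S' T').const_mul d),
      integral_const_mul, integral_const_mul]
  have hf : ∀ k, fstar k = P.real (X ⁻¹' {k}) * P.real (Y ⁻¹' Set.Icc (k - τ) k) / α := by
    intro k
    rw [hfstar, ← hind]
    congr 3
    ext ω
    simp only [Set.mem_inter_iff, Set.mem_setOf_eq, Set.mem_singleton_iff, Set.mem_Icc]
    omega
  have hC : ∀ k, Cτ k = P.real (X ⁻¹' Set.Ici k) * P.real (Y ⁻¹' Set.Icc (k - τ) k) / α := by
    intro k
    rw [hCτ, ← hind]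
    congr 3
    ext ω
    simp only [Set.mem_inter_iff, Set.mem_setOf_eq, Set.mem_Ici, Set.mem_Icc]
    omega
  have hIf : ∀ k, ∫ ω, I {k} (Set.Icc (k - τ) k) ω ∂Q = fstar k := by
    intro k
    rw [hf, hIval]
    intro x hx y hy
    simp only [Set.mem_singleton_iff, Set.mem_Icc] at hx hy
    omega
  have hIC : ∀ k, ∫ ω, I (Set.Ici k) (Set.Icc (k - τ) k) ω ∂Q = Cτ k := by
    intro k
    rw [hC, hIval]
    intro x hx y hy
    simp only [Set.mem_Ici, Set.mem_Icc] at hx hy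
    omega
  have hZI : ∀ k ω, Yst ω ≤ Xst ω → Zτ k ω = Cτ k * I {k} (Set.Icc (k - τ) k) ω
      + (- fstar k) * I (Set.Ici k) (Set.Icc (k - τ) k) ω := by
    intro k ω h
    rw [hZτ]
    have e1 : (Xst ω = k ∧ Xst ω ≤ Yst ω + τ) ↔
        (Xst ω ∈ ({k} : Set ℤ) ∧ Yst ω ∈ Set.Icc (k - τ) k) := by
      simp only [Set.mem_singleton_iff, Set.mem_Icc]; omega
    have e2 : (Yst ω ≤ k ∧ k ≤ min (Xst ω) (Yst ω + τ)) ↔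
        (Xst ω ∈ Set.Ici k ∧ Yst ω ∈ Set.Icc (k - τ) k) := by
      simp only [Set.mem_Ici, Set.mem_Icc]; omega
    simp only [I, e1, e2]
    ring
  have hmean : ∀ k, ∫ ω, Zτ k ω ∂Q = 0 := by
    intro k
    rw [integral_congr_ae (g := fun ω => Cτ k * I {k} (Set.Icc (k - τ) k) ω
      + (- fstar k) * I (Set.Ici k) (Set.Icc (k - τ) k) ω)
      (by filter_upwards [hae] with ω h using hZI k ω h), hlin, hIf, hIC]
    ring
  have hdiag : ∀ k, ∫ ω, Zτ k ω * Zτ k ω ∂Q = Cτ k * fstar k * (Cτ k - fstar k) := by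
    intro k
    rw [integral_congr_ae (g := fun ω =>
      (Cτ k ^ 2 - 2 * Cτ k * fstar k) * I {k} (Set.Icc (k - τ) k) ω
      + (fstar k ^ 2) * I (Set.Ici k) (Set.Icc (k - τ) k) ω) ?_, hlin, hIf, hIC]
    · ring
    · filter_upwards [hae] with ω h
      rw [hZI k ω h]
      simp only [I, Set.mem_singleton_iff, Set.mem_Icc, Set.mem_Ici]
      split_ifs <;> first | (exfalso; omega) | ring
  have hoff : ∀ k k', k < k' → ∫ ω, Zτ k ω * Zτ k' ω ∂Q = 0 := by
    intro k k' hk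
    rw [integral_congr_ae (g := fun ω =>
      (- (fstar k * Cτ k')) * I {k'} (Set.Icc (k' - τ) k) ω
      + (fstar k * fstar k') * I (Set.Ici k') (Set.Icc (k' - τ) k) ω) ?_, hlin, hIval, hIval,
      hf k', hC k']
    · ring
    · intro x hx y hy
      simp only [Set.mem_Ici, Set.mem_Icc] at hx hy
      omega
    · intro x hx y hy
      simp only [Set.mem_singleton_iff, Set.mem_Icc] at hx hy
      omega
    · filter_upwards [hae] with ω h
      rw [hZI k ω h, hZI k' ω h]
      simp only [I, Set.mem_singleton_iff, Set.mem_Icc, Set.mem_Ici]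
      split_ifs <;> first | (exfalso; omega) | ring
  intro k k' _ _
  rw [hmean, hmean]
  rcases lt_trichotomy k k' with h | h | h
  · rw [hoff k k' h, if_neg h.ne]; ring
  · subst h
    rw [hdiag, if_pos rfl]; ring
  · simp only [mul_comm (Zτ k _)]
    rw [hoff k' k h, if_neg h.ne']; ring
end

section
/- Let f : ℤ → ℤ be any function satisfying f(y) ≥ y for all positive integers y, and set C := f(Y). Then for every positive integer x, P(Y ≤ x ≤ min(X, C) | X ≥ Y) = P(Y ≤ x ≤ C)·P(X ≥ x)/α and P(X = x, X ≤ C | X ≥ Y) = P(X = x)·P(Y ≤ x ≤ C)/α, where α := P(X ≥ Y); consequently, whenever P(Y ≤ x ≤ min(X, C) | X ≥ Y) > 0 and P(X ≥ x) > 0, the ratio P(X = x, X ≤ C | X ≥ Y) / P(Y ≤ x ≤ min(X, C) | X ≥ Y) equals the hazard rate λ(x) = P(X = x)/P(X ≥ x). -/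
open MeasureTheory ProbabilityTheory Filter Finset

/-- The factorizations of `C_τ` and `f_{*,τ}`, and the recovery of the
hazard rate, hold more generally for a censoring variable `C = f(Y)` with `C ≥ Y`. -/
theorem stmt17
    {Ω : Type*} [MeasurableSpace Ω] (P : Measure Ω) [IsProbabilityMeasure P]
    (X Y : Ω → ℤ) (hX : Measurable X) (hY : Measurable Y)
    (hXpos : ∀ ω, 0 < X ω) (hYpos : ∀ ω, 0 < Y ω)
    (hindep : IndepFun X Y P)
    (α : ℝ) (hα : α = (P {ω | Y ω ≤ X ω}).toReal) (hαpos : 0 < α)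
    -- the censoring variable `C = f(Y)` with `C ≥ Y`
    (f : ℤ → ℤ) (hf : ∀ y : ℤ, 0 < y → y ≤ f y) :
    ∀ x : ℤ, 0 < x →
      ((P ({ω | Y ω ≤ x ∧ x ≤ X ω ∧ x ≤ f (Y ω)} ∩ {ω | Y ω ≤ X ω})).toReal / α
          = (P {ω | Y ω ≤ x ∧ x ≤ f (Y ω)}).toReal * (P {ω | x ≤ X ω}).toReal / α)
        ∧ ((P ({ω | X ω = x ∧ X ω ≤ f (Y ω)} ∩ {ω | Y ω ≤ X ω})).toReal / α
          = (P {ω | X ω = x}).toReal * (P {ω | Y ω ≤ x ∧ x ≤ f (Y ω)}).toReal / α)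
        ∧ (0 < (P ({ω | Y ω ≤ x ∧ x ≤ X ω ∧ x ≤ f (Y ω)} ∩ {ω | Y ω ≤ X ω})).toReal / α →
            0 < (P {ω | x ≤ X ω}).toReal →
            ((P ({ω | X ω = x ∧ X ω ≤ f (Y ω)} ∩ {ω | Y ω ≤ X ω})).toReal / α)
              / ((P ({ω | Y ω ≤ x ∧ x ≤ X ω ∧ x ≤ f (Y ω)} ∩ {ω | Y ω ≤ X ω})).toReal / α)
              = (P {ω | X ω = x}).toReal / (P {ω | x ≤ X ω}).toReal) := by
  intro x hx
  have key : ∀ A B : Set ℤ, (P (X ⁻¹' A ∩ Y ⁻¹' B)).toReal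
      = (P (X ⁻¹' A)).toReal * (P (Y ⁻¹' B)).toReal := by
    intro A B
    rw [hindep.measure_inter_preimage_eq_mul A B (MeasurableSet.of_discrete)
      (MeasurableSet.of_discrete), ENNReal.toReal_mul]
  have h1 : (P ({ω | Y ω ≤ x ∧ x ≤ X ω ∧ x ≤ f (Y ω)} ∩ {ω | Y ω ≤ X ω})).toReal
      = (P {ω | x ≤ X ω}).toReal * (P {ω | Y ω ≤ x ∧ x ≤ f (Y ω)}).toReal := by
    refine Eq.trans ?_ (key {a | x ≤ a} {b | b ≤ x ∧ x ≤ f b})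
    congr 2
    ext ω
    simp only [Set.mem_inter_iff, Set.mem_setOf_eq, Set.mem_preimage]
    constructor
    · rintro ⟨⟨a, b, c⟩, d⟩
      exact ⟨b, a, c⟩
    · rintro ⟨b, a, c⟩
      exact ⟨⟨a, b, c⟩, a.trans b⟩
  have h2 : (P ({ω | X ω = x ∧ X ω ≤ f (Y ω)} ∩ {ω | Y ω ≤ X ω})).toReal
      = (P {ω | X ω = x}).toReal * (P {ω | Y ω ≤ x ∧ x ≤ f (Y ω)}).toReal := by
    refine Eq.trans ?_ (key {a | a = x} {b | b ≤ x ∧ x ≤ f b})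
    congr 2
    ext ω
    simp only [Set.mem_inter_iff, Set.mem_setOf_eq, Set.mem_preimage]
    constructor
    · rintro ⟨⟨a, b⟩, c⟩
      exact ⟨a, a ▸ c, a ▸ b⟩
    · rintro ⟨a, b, c⟩
      exact ⟨⟨a, a.symm ▸ c⟩, a.symm ▸ b⟩
  rw [h1, h2]
  refine ⟨by rw [mul_comm], rfl, ?_⟩
  intro h3 h4
  have h5 : (P {ω | Y ω ≤ x ∧ x ≤ f (Y ω)}).toReal ≠ 0 := by
    intro h
    rw [h] at h3
    simp at h3
  rw [div_div_div_cancel_right₀ hαpos.ne', mul_div_mul_right _ _ h5]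
end
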